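/- arXiv:math/0307270 — 3 statements merged into one kernel-verified Lean document; each statement's English description precedes it below -/
import Mathlib

section
/- Let φ : ℝ² → ℝ be a smooth solution of the sine-Gordon equation and let U : ℝ²×(ℂ∖{0}) → GL₂(ℂ) be smooth in (x,y), holomorphic and twisted in λ, satisfying for every real λ ≠ 0 the Lax system ∂ₓU = U·A_φ(·,·,λ), ∂_yU = U·B_φ(·,·,λ) and U(0,0,λ) = I. Suppose U = U₋·V₊ on ℝ²×(ℂ∖{0}), where U₋ : ℝ²×(ℂ∖{0}) → GL₂(ℂ) is smooth in (x,y), holomorphic and twisted in λ, holomorphic at ∞ with value I there, and V₊ : ℝ²×ℂ → GL₂(ℂ) is smooth in (x,y), entire and twisted in λ, with invertible values. Then ∂ₓU₋ = 0 (so U₋ depends only on y and λ), and U₋(y,λ)⁻¹·∂_yU₋(y,λ) = λ⁻¹·(i/2)·[[0, e^{−i·φ(0,y)}], [e^{i·φ(0,y)}, 0]], with U₋ = I at y = 0. -/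
open Matrix Complex

attribute [local instance] Matrix.normedAddCommGroup Matrix.normedSpace

noncomputable section

/-- The Pauli matrix σ₃. -/
def sigma3 : Matrix (Fin 2) (Fin 2) ℂ := !![1, 0; 0, -1]

/-- The matrix `A_φ(x,y,λ) = (i/2)·[[∂ₓφ, −λ], [−λ, −∂ₓφ]]` of the Lax system. -/
def Aphi (φ : ℝ → ℝ → ℝ) (lam : ℂ) (x y : ℝ) : Matrix (Fin 2) (Fin 2) ℂ :=
  (Complex.I / 2) •
    !![((deriv (fun x' => φ x' y) x : ℝ) : ℂ), -lam;
       -lam, -((deriv (fun x' => φ x' y) x : ℝ) : ℂ)]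

/-- The matrix `B_φ(x,y,λ) = (i/2)·λ⁻¹·[[0, e^{−iφ}], [e^{iφ}, 0]]` of the Lax system. -/
def Bphi (φ : ℝ → ℝ → ℝ) (lam : ℂ) (x y : ℝ) : Matrix (Fin 2) (Fin 2) ℂ :=
  (Complex.I / 2) • lam⁻¹ •
    !![0, Complex.exp (-Complex.I * ((φ x y : ℝ) : ℂ));
       Complex.exp (Complex.I * ((φ x y : ℝ) : ℂ)), 0]

/-- Membership in SU(2): unitary with determinant one. -/
def IsSU2 (g : Matrix (Fin 2) (Fin 2) ℂ) : Prop := g * gᴴ = 1 ∧ g.det = 1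

/-- The bilinear pairing `⟨X,Y⟩ = −2·tr(X·Y)` on 2×2 complex matrices. -/
def pairing (X Y : Matrix (Fin 2) (Fin 2) ℂ) : ℂ := -2 * (X * Y).trace

/-- `g : ℂ∖{0} → M₂(ℂ)` is holomorphic at `∞` with value `L` if `μ ↦ g(1/μ)` extends
holomorphically (analytically) to `μ = 0` with value `L` there. -/
def HolomAtInfty (g : ℂ → Matrix (Fin 2) (Fin 2) ℂ) (L : Matrix (Fin 2) (Fin 2) ℂ) : Prop :=
  ∃ G : ℂ → Matrix (Fin 2) (Fin 2) ℂ,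
    AnalyticAt ℂ G 0 ∧ G 0 = L ∧ ∀ μ : ℂ, μ ≠ 0 → G μ = g μ⁻¹

section LinearODE

open Filter Topology MeasureTheory

variable {E : Type*} [NormedAddCommGroup E] [NormedSpace ℂ E]

/-- The `n`-th Picard iterate increment for the linear equation `w' = A w` started at `v`. -/
def picardTerm (A : ℝ → E →L[ℂ] E) (v : E) : ℕ → ℝ → E
  | 0 => fun _ => v
  | n + 1 => fun t => ∫ s in (0 : ℝ)..t, A s (picardTerm A v n s)

lemma hasDerivAt_integral_of_continuous [CompleteSpace E] {f : ℝ → E} (hf : Continuous f)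
    (t : ℝ) : HasDerivAt (fun u => ∫ s in (0 : ℝ)..u, f s) (f t) t :=
  (hf.integral_hasStrictDerivAt 0 t).hasDerivAt

lemma continuous_integral_of_continuous [CompleteSpace E] {f : ℝ → E} (hf : Continuous f) :
    Continuous (fun u => ∫ s in (0 : ℝ)..u, f s) :=
  continuous_iff_continuousAt.2 fun t => (hasDerivAt_integral_of_continuous hf t).continuousAt

lemma continuous_picardTerm [CompleteSpace E] {A : ℝ → E →L[ℂ] E} (hA : Continuous A) (v : E)
    (n : ℕ) : Continuous (picardTerm A v n) := by
  induction n with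
  | zero => exact continuous_const
  | succ n ih => exact continuous_integral_of_continuous (hA.clm_apply ih)

lemma norm_picardTerm_le [CompleteSpace E] {A : ℝ → E →L[ℂ] E} (hA : Continuous A) (v : E)
    {T K : ℝ} (hK : ∀ s, |s| ≤ T → ‖A s‖ ≤ K) (n : ℕ) (t : ℝ) (ht : |t| ≤ T) :
    ‖picardTerm A v n t‖ ≤ ‖v‖ * (K ^ n * |t| ^ n / n.factorial) := by
  have hK0 : 0 ≤ K := (norm_nonneg _).trans (hK t ht)
  induction n generalizing t with
  | zero => simp [picardTerm]
  | succ n ih =>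
    have hc := hA.clm_apply (continuous_picardTerm hA v n)
    calc ‖picardTerm A v (n + 1) t‖
        ≤ ∫ s in Set.uIoc 0 t, ‖A s (picardTerm A v n s)‖ :=
          intervalIntegral.norm_integral_le_integral_norm_uIoc
      _ ≤ ∫ s in Set.uIoc 0 t, (‖v‖ * K ^ (n + 1) / n.factorial) * |s - 0| ^ n := by
          refine setIntegral_mono_on ?_ ?_ measurableSet_uIoc fun s hs => ?_
          · exact (hc.norm.intervalIntegrable 0 t).def'
          · have : Continuous fun s : ℝ => (‖v‖ * K ^ (n + 1) / n.factorial) * |s - 0| ^ n := by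
              fun_prop
            exact (this.intervalIntegrable 0 t).def'
          · have hst : |s| ≤ |t| := by
              have := Set.abs_sub_left_of_mem_uIcc (Set.uIoc_subset_uIcc hs)
              simpa using this
            have hs' := hst.trans ht
            calc ‖A s (picardTerm A v n s)‖ ≤ ‖A s‖ * ‖picardTerm A v n s‖ :=
                  (A s).le_opNorm _
              _ ≤ K * (‖v‖ * (K ^ n * |s| ^ n / n.factorial)) :=
                  mul_le_mul (hK s hs') (ih s hs') (norm_nonneg _) hK0
              _ = (‖v‖ * K ^ (n + 1) / n.factorial) * |s - 0| ^ n := by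
                  rw [sub_zero]; ring
      _ = ‖v‖ * (K ^ (n + 1) * |t| ^ (n + 1) / (n + 1).factorial) := by
          rw [integral_const_mul, integral_pow_abs_sub_uIoc, sub_zero, Nat.factorial_succ]
          push_cast
          field_simp

lemma exists_norm_le_of_continuous {F : Type*} [NormedAddCommGroup F] {A : ℝ → F}
    (hA : Continuous A) (T : ℝ) : ∃ K, 0 ≤ K ∧ ∀ s, |s| ≤ T → ‖A s‖ ≤ K := by
  obtain ⟨K, hK⟩ := (isCompact_Icc (a := -T) (b := T)).exists_bound_of_continuousOn
    hA.continuousOn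
  exact ⟨max K 0, le_max_right _ _, fun s hs => (hK s (abs_le.1 hs)).trans (le_max_left _ _)⟩

lemma summable_picard_bound (c K T : ℝ) :
    Summable fun n : ℕ => c * (K ^ n * T ^ n / n.factorial) := by
  simp_rw [← mul_pow]
  exact (Real.summable_pow_div_factorial (K * T)).mul_left c

lemma summable_picardTerm [CompleteSpace E] {A : ℝ → E →L[ℂ] E} (hA : Continuous A) (v : E)
    (t : ℝ) : Summable fun n => picardTerm A v n t := by
  obtain ⟨K, -, hK⟩ := exists_norm_le_of_continuous hA |t|
  exact .of_norm_bounded (summable_picard_bound ‖v‖ K |t|)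
    fun n => norm_picardTerm_le hA v hK n t le_rfl

lemma hasDerivAt_tsum_picardTerm [CompleteSpace E] {A : ℝ → E →L[ℂ] E} (hA : Continuous A)
    (v : E) (t : ℝ) :
    HasDerivAt (fun t => ∑' n, picardTerm A v n t) (A t (∑' n, picardTerm A v n t)) t := by
  have hsum : (fun t => ∑' n, picardTerm A v n t) =
      fun t => v + ∑' n, picardTerm A v (n + 1) t :=
    funext fun t => (summable_picardTerm hA v t).tsum_eq_zero_add
  obtain ⟨K, hK0, hK⟩ := exists_norm_le_of_continuous hA (|t| + 1)
  have ht : t ∈ Set.Ioo (-(|t| + 1)) (|t| + 1) := abs_lt.1 (lt_add_one _)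
  rw [(A t).map_tsum (summable_picardTerm hA v t), hsum]
  refine HasDerivAt.const_add v (hasDerivAt_tsum_of_isPreconnected (y₀ := t)
    (u := fun n : ℕ => K * (‖v‖ * (K ^ n * (|t| + 1) ^ n / n.factorial)))
    (g' := fun n s => A s (picardTerm A v n s))
    ((summable_picard_bound _ _ _).mul_left K) isOpen_Ioo isPreconnected_Ioo
    (fun n s _ => hasDerivAt_integral_of_continuous
      (hA.clm_apply (continuous_picardTerm hA v n)) s) (fun n s hs => ?_) ht
    ((summable_nat_add_iff 1).2 (summable_picardTerm hA v t)) ht)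
  have hs' : |s| ≤ |t| + 1 := (abs_lt.2 hs).le
  refine ((A s).le_opNorm _).trans (mul_le_mul (hK s hs') ?_ (norm_nonneg _) hK0)
  refine (norm_picardTerm_le hA v hK n s hs').trans ?_
  gcongr

lemma picardTerm_affine [CompleteSpace E] {C D : ℝ → E →L[ℂ] E} (hC : Continuous C)
    (hD : Continuous D) (v : E) (n : ℕ) :
    ∃ (ι : Type) (_ : Fintype ι) (p : ι → ℕ) (Q : ι → ℝ → E), (∀ i, Continuous (Q i)) ∧
      ∀ (z : ℂ) (t : ℝ), picardTerm (fun s => C s + z • D s) v n t = ∑ i, z ^ p i • Q i t := by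
  induction n with
  | zero => exact ⟨Unit, inferInstance, fun _ => 0, fun _ _ => v, fun _ => continuous_const,
      fun z t => by simp [picardTerm]⟩
  | succ n ih =>
    obtain ⟨ι, _, p, Q, hQ, h⟩ := ih
    have hCQ := fun i => hC.clm_apply (hQ i)
    have hDQ := fun i => hD.clm_apply (hQ i)
    refine ⟨ι ⊕ ι, inferInstance, Sum.elim p (fun i => p i + 1),
      Sum.elim (fun i t => ∫ s in (0 : ℝ)..t, C s (Q i s))
        (fun i t => ∫ s in (0 : ℝ)..t, D s (Q i s)), ?_, fun z t => ?_⟩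
    · rintro (i | i)
      · exact continuous_integral_of_continuous (hCQ i)
      · exact continuous_integral_of_continuous (hDQ i)
    · have hint : ∀ s, (C s + z • D s) (picardTerm (fun s => C s + z • D s) v n s) =
          ∑ i, (z ^ p i • C s (Q i s) + z ^ (p i + 1) • D s (Q i s)) := fun s => by
        simp only [h, map_sum, map_smul, _root_.add_apply,
          _root_.smul_apply, smul_add, Finset.sum_add_distrib, smul_smul, pow_succ]
      simp only [picardTerm, hint, Fintype.sum_sum_type, Sum.elim_inl, Sum.elim_inr]
      rw [intervalIntegral.integral_finsetSum fun i _ => Continuous.intervalIntegrable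
        (((hCQ i).fun_const_smul _).fun_add ((hDQ i).fun_const_smul _)) _ _, ← Finset.sum_add_distrib]
      refine Finset.sum_congr rfl fun i _ => ?_
      rw [intervalIntegral.integral_add (((hCQ i).fun_const_smul _).intervalIntegrable _ _)
        (((hDQ i).fun_const_smul _).intervalIntegrable _ _), intervalIntegral.integral_smul,
        intervalIntegral.integral_smul]

/-- A linear equation whose coefficient is affine in a complex parameter has a global solution
that is entire in the parameter. -/
lemma exists_linearODE_solution_entire [CompleteSpace E] {C D : ℝ → E →L[ℂ] E}
    (hC : Continuous C) (hD : Continuous D) (v : E) :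
    ∃ W : ℝ → ℂ → E, (∀ z, W 0 z = v) ∧
      (∀ t z, HasDerivAt (fun s => W s z) ((C t + z • D t) (W t z)) t) ∧
      ∀ t, Differentiable ℂ (W t) := by
  have hA : ∀ z : ℂ, Continuous fun s => C s + z • D s := fun z => hC.add (hD.const_smul z)
  refine ⟨fun t z => ∑' n, picardTerm (fun s => C s + z • D s) v n t, fun z => ?_,
    fun t z => hasDerivAt_tsum_picardTerm (hA z) v t, fun t z₀ => ?_⟩
  · beta_reduce
    rw [tsum_eq_single 0 fun n hn => ?_]
    · rfl
    · obtain ⟨m, rfl⟩ := Nat.exists_eq_succ_of_ne_zero hn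
      simp [picardTerm]
  · obtain ⟨KC, -, hKC⟩ := exists_norm_le_of_continuous hC |t|
    obtain ⟨KD, hKD0, hKD⟩ := exists_norm_le_of_continuous hD |t|
    have hz₀ : Metric.ball (0 : ℂ) (‖z₀‖ + 1) ∈ 𝓝 z₀ :=
      Metric.isOpen_ball.mem_nhds (by simp)
    refine (Complex.differentiableOn_tsum_of_summable_norm
      (summable_picard_bound ‖v‖ (KC + (‖z₀‖ + 1) * KD) |t|) (fun n => ?_) Metric.isOpen_ball
      fun n z hz => ?_).differentiableAt hz₀
    · obtain ⟨ι, _, p, Q, -, h⟩ := picardTerm_affine hC hD v n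
      simp only [h]
      fun_prop
    · refine norm_picardTerm_le (hA z) v (fun s hs => ?_) n t le_rfl
      have hz' : ‖z‖ ≤ ‖z₀‖ + 1 := by simpa using (mem_ball_zero_iff.1 hz).le
      calc ‖C s + z • D s‖ ≤ ‖C s‖ + ‖z‖ * ‖D s‖ :=
            (norm_add_le _ _).trans (by rw [norm_smul])
        _ ≤ _ := by gcongr <;> [exact hKC s hs; exact hKD s hs]

end LinearODE

section MatrixFrame

open Filter Topology

lemma HasDerivAt.matrix_mul {F G : ℝ → Matrix (Fin 2) (Fin 2) ℂ}
    {F' G' : Matrix (Fin 2) (Fin 2) ℂ} {t : ℝ} (hF : HasDerivAt F F' t)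
    (hG : HasDerivAt G G' t) :
    HasDerivAt (fun s => F s * G s) (F' * G t + F t * G') t := by
  refine hasDerivAt_pi.2 fun i => hasDerivAt_pi.2 fun j => ?_
  have hF' := fun i j => hasDerivAt_pi.1 (hasDerivAt_pi.1 hF i) j
  have hG' := fun i j => hasDerivAt_pi.1 (hasDerivAt_pi.1 hG i) j
  simp only [Matrix.mul_apply, Matrix.add_apply, ← Finset.sum_add_distrib]
  exact HasDerivAt.fun_sum fun k _ => (hF' i k).mul (hG' k j)

lemma DifferentiableOn.matrix_mul {F G : ℂ → Matrix (Fin 2) (Fin 2) ℂ} {S : Set ℂ}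
    (hF : DifferentiableOn ℂ F S) (hG : DifferentiableOn ℂ G S) :
    DifferentiableOn ℂ (fun z => F z * G z) S := by
  refine differentiableOn_pi.2 fun i => differentiableOn_pi.2 fun j => ?_
  have hF' := fun i j => differentiableOn_pi.1 (differentiableOn_pi.1 hF i) j
  have hG' := fun i j => differentiableOn_pi.1 (differentiableOn_pi.1 hG i) j
  simp only [Matrix.mul_apply]
  exact DifferentiableOn.fun_sum fun k _ => (hF' i k).mul (hG' k j)

/-- Right multiplication by a matrix, as a continuous linear map depending linearly on it. -/
def mulRightCLM : Matrix (Fin 2) (Fin 2) ℂ →ₗ[ℂ]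
    Matrix (Fin 2) (Fin 2) ℂ →L[ℂ] Matrix (Fin 2) (Fin 2) ℂ :=
  LinearMap.toContinuousLinearMap.toLinearMap ∘ₗ (LinearMap.mul ℂ _).flip

/-- Left multiplication by a matrix, as a continuous linear map depending linearly on it. -/
def mulLeftCLM : Matrix (Fin 2) (Fin 2) ℂ →ₗ[ℂ]
    Matrix (Fin 2) (Fin 2) ℂ →L[ℂ] Matrix (Fin 2) (Fin 2) ℂ :=
  LinearMap.toContinuousLinearMap.toLinearMap ∘ₗ LinearMap.mul ℂ _

lemma mulRightCLM_apply (A X : Matrix (Fin 2) (Fin 2) ℂ) : mulRightCLM A X = X * A := rfl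

lemma mulLeftCLM_apply (A X : Matrix (Fin 2) (Fin 2) ℂ) : mulLeftCLM A X = A * X := rfl

/-- The fundamental solution of a matrix equation whose coefficient is affine in a complex
parameter: it is entire in the parameter together with its inverse, and every solution is a
constant left multiple of it. -/
lemma exists_fundamental_solution {C D : ℝ → Matrix (Fin 2) (Fin 2) ℂ} (hC : Continuous C)
    (hD : Continuous D) :
    ∃ W V : ℝ → ℂ → Matrix (Fin 2) (Fin 2) ℂ, (∀ z, W 0 z = 1) ∧
      (∀ t z, HasDerivAt (fun s => W s z) (W t z * (C t + z • D t)) t) ∧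
      (∀ t, Differentiable ℂ (W t)) ∧ (∀ t, Differentiable ℂ (V t)) ∧
      (∀ t z, W t z * V t z = 1) ∧
      ∀ (z : ℂ) (X : ℝ → Matrix (Fin 2) (Fin 2) ℂ),
        (∀ t, HasDerivAt X (X t * (C t + z • D t)) t) → ∀ t, X t = X 0 * W t z := by
  have hR : Continuous mulRightCLM := LinearMap.continuous_of_finiteDimensional _
  have hL : Continuous mulLeftCLM := LinearMap.continuous_of_finiteDimensional _
  obtain ⟨W, hW0, hWd, hWz⟩ := exists_linearODE_solution_entire (hR.comp hC) (hR.comp hD) 1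
  obtain ⟨V, hV0, hVd, hVz⟩ := exists_linearODE_solution_entire (hL.comp hC.neg)
    (hL.comp hD.neg) 1
  have hWd' : ∀ t z, HasDerivAt (fun s => W s z) (W t z * (C t + z • D t)) t := fun t z => by
    have h : (mulRightCLM (C t) + z • mulRightCLM (D t)) (W t z) =
        W t z * (C t + z • D t) := by
      rw [← map_smul, ← map_add, mulRightCLM_apply]
    exact h ▸ hWd t z
  have hVd' : ∀ t z, HasDerivAt (fun s => V s z) (-((C t + z • D t) * V t z)) t := fun t z => by
    have h : (mulLeftCLM (-C t) + z • mulLeftCLM (-D t)) (V t z) =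
        -((C t + z • D t) * V t z) := by
      rw [← map_smul, ← map_add, mulLeftCLM_apply, smul_neg, ← neg_add, neg_mul]
    exact h ▸ hVd t z
  have key : ∀ (z : ℂ) (X : ℝ → Matrix (Fin 2) (Fin 2) ℂ),
      (∀ t, HasDerivAt X (X t * (C t + z • D t)) t) → ∀ t, X t * V t z = X 0 := by
    intro z X hX t
    have h : ∀ t, HasDerivAt (fun s => X s * V s z) 0 t := fun t => by
      convert (hX t).matrix_mul (hVd' t z) using 1
      simp [mul_assoc]
    have := is_const_of_deriv_eq_zero (fun t => (h t).differentiableAt) (fun t => (h t).deriv) t 0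
    simpa [hV0] using this
  have hWV : ∀ t z, W t z * V t z = 1 := fun t z => by
    simpa [hW0] using key z (fun s => W s z) (fun s => hWd' s z) t
  refine ⟨W, V, hW0, hWd', hWz, hVz, hWV, fun z X hX t => ?_⟩
  rw [← key z X hX t, mul_assoc, mul_eq_one_comm.1 (hWV t z), mul_one]

/-- Two holomorphic functions on the punctured plane agreeing on the nonzero reals are equal. -/
lemma eq_of_eq_on_real {F : Type*} [NormedAddCommGroup F] [NormedSpace ℂ F] [CompleteSpace F]
    {f g : ℂ → F} (hf : DifferentiableOn ℂ f {0}ᶜ) (hg : DifferentiableOn ℂ g {0}ᶜ)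
    (h : ∀ r : ℝ, r ≠ 0 → f r = g r) {z : ℂ} (hz : z ≠ 0) : f z = g z := by
  have hpre : IsPreconnected ({0}ᶜ : Set ℂ) :=
    (isConnected_compl_singleton_of_one_lt_rank (by simp) 0).isPreconnected
  refine (hf.analyticOnNhd isOpen_compl_singleton).eqOn_of_preconnected_of_frequently_eq
    (hg.analyticOnNhd isOpen_compl_singleton) hpre (z₀ := 1) (by simp) ?_ hz
  have htend : Tendsto (fun r : ℝ => (r : ℂ)) (𝓝[≠] 1) (𝓝[≠] 1) := by
    refine tendsto_nhdsWithin_iff.2 ⟨?_, ?_⟩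
    · exact (Complex.continuous_ofReal.tendsto' 1 1 (by simp)).mono_left nhdsWithin_le_nhds
    · filter_upwards [self_mem_nhdsWithin] with r hr
      simpa using hr
  have hev : ∀ᶠ r : ℝ in 𝓝[≠] 1, f r = g r := by
    filter_upwards [nhdsWithin_le_nhds (isOpen_ne.mem_nhds (one_ne_zero (α := ℝ)))] with r hr
    exact h r hr
  exact htend.frequently hev.frequently

lemma HolomAtInfty.tendsto {g : ℂ → Matrix (Fin 2) (Fin 2) ℂ}
    {L : Matrix (Fin 2) (Fin 2) ℂ} (h : HolomAtInfty g L) :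
    Tendsto g (cocompact ℂ) (𝓝 L) := by
  obtain ⟨G, hG, rfl, hGg⟩ := h
  rw [← Metric.cobounded_eq_cocompact]
  refine (hG.continuousAt.tendsto.comp tendsto_inv₀_cobounded).congr' ?_
  filter_upwards [Bornology.eventually_ne_cobounded (0 : ℂ)] with z hz
  simp [hGg _ (inv_ne_zero hz)]

lemma tendsto_matrix_inv_one {α : Type*} {l : Filter α} {g : α → Matrix (Fin 2) (Fin 2) ℂ}
    (h : Tendsto g l (𝓝 1)) : Tendsto (fun a => (g a)⁻¹) l (𝓝 1) := by
  have hdet : Tendsto (fun a => (g a).det) l (𝓝 1) := by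
    exact ((continuous_id.matrix_det).tendsto' (1 : Matrix (Fin 2) (Fin 2) ℂ) 1 (by simp)).comp h
  have hadj : Tendsto (fun a => (g a).adjugate) l (𝓝 1) := by
    exact ((continuous_id.matrix_adjugate).tendsto' (1 : Matrix (Fin 2) (Fin 2) ℂ) 1 (by simp)).comp h
  simpa [Matrix.inv_def] using (hdet.inv₀ one_ne_zero).smul hadj

/-- A Birkhoff splitting of a function that extends to infinity with value `1` has the function
itself as its negative factor. -/
lemma birkhoff_minus_factor_unique {F Um h : ℂ → Matrix (Fin 2) (Fin 2) ℂ}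
    (hF : Tendsto F (cocompact ℂ) (𝓝 1)) (hUm : Tendsto Um (cocompact ℂ) (𝓝 1))
    (hinv : ∀ z, z ≠ 0 → IsUnit (Um z)) (hh : Differentiable ℂ h)
    (hfac : ∀ z, z ≠ 0 → F z = Um z * h z) (z : ℂ) (hz : z ≠ 0) : Um z = F z := by
  have hlim : Tendsto h (cocompact ℂ) (𝓝 1) := by
    have := (tendsto_matrix_inv_one hUm).mul hF
    rw [mul_one] at this
    refine this.congr' ?_
    rw [← Metric.cobounded_eq_cocompact]
    filter_upwards [Bornology.eventually_ne_cobounded (0 : ℂ)] with z hz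
    rw [hfac z hz, Matrix.nonsing_inv_mul_cancel_left _ _
      ((Matrix.isUnit_iff_isUnit_det _).1 (hinv z hz))]
  rw [hfac z hz, hh.apply_eq_of_tendsto_cocompact z hlim, mul_one]

end MatrixFrame

/-- The negative Birkhoff factor of the extended frame is a fundamental solution, in the
parameter `λ⁻¹`, of the `y`-equation of the Lax system along `x = 0`. -/
lemma exists_birkhoff_minus_factor_frame
    {φ : ℝ → ℝ → ℝ} (hφ : ContDiff ℝ (⊤ : ℕ∞) (fun p : ℝ × ℝ => φ p.1 p.2))
    {U Um Vp : ℝ → ℝ → ℂ → Matrix (Fin 2) (Fin 2) ℂ}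
    (hUhol : ∀ x y : ℝ, DifferentiableOn ℂ (U x y) {0}ᶜ)
    (hLax : ∀ lam : ℝ, lam ≠ 0 → ∀ x y : ℝ,
      HasDerivAt (fun x' => U x' y (lam : ℂ)) (U x y (lam : ℂ) * Aphi φ (lam : ℂ) x y) x ∧
      HasDerivAt (fun y' => U x y' (lam : ℂ)) (U x y (lam : ℂ) * Bphi φ (lam : ℂ) x y) y)
    (hUinit : ∀ lam : ℝ, lam ≠ 0 → U 0 0 (lam : ℂ) = 1)
    (hUminv : ∀ x y : ℝ, ∀ lam : ℂ, lam ≠ 0 → IsUnit (Um x y lam))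
    (hUminf : ∀ x y : ℝ, HolomAtInfty (Um x y) 1)
    (hVphol : ∀ x y : ℝ, Differentiable ℂ (Vp x y))
    (hfac : ∀ x y : ℝ, ∀ lam : ℂ, lam ≠ 0 → U x y lam = Um x y lam * Vp x y lam) :
    ∃ F : ℝ → ℂ → Matrix (Fin 2) (Fin 2) ℂ, (∀ z, F 0 z = 1) ∧
      (∀ y z, HasDerivAt (fun y' => F y' z) (F y z * Bphi φ z⁻¹ 0 y) y) ∧
      ∀ x y lam, lam ≠ 0 → Um x y lam = F y lam⁻¹ := by
  have hφx : ∀ y, ContDiff ℝ (⊤ : ℕ∞) fun x => φ x y := fun y =>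
    hφ.comp (contDiff_id.prodMk contDiff_const)
  have hφy : Continuous fun y => φ 0 y := hφ.continuous.comp (Continuous.prodMk_right 0)
  have hB : ∀ z y, (0 : Matrix (Fin 2) (Fin 2) ℂ) + z • Bphi φ 1 0 y = Bphi φ z⁻¹ 0 y := by
    intro z y
    rw [zero_add, Bphi, Bphi, inv_inv, inv_one, one_smul, smul_comm]
  have hB1 : Continuous fun y => Bphi φ 1 0 y := by
    refine Continuous.fun_const_smul (Continuous.fun_const_smul ?_ _) _
    refine continuous_matrix fun i j => ?_
    fin_cases i <;> fin_cases j <;> simp <;> fun_prop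
  obtain ⟨F, -, hF0, hFd, hFz, -, -, hFu⟩ :=
    exists_fundamental_solution (continuous_const (y := 0)) hB1
  simp only [hB] at hFd hFu
  have hUF : ∀ y lam, lam ≠ 0 → U 0 y lam = F y lam⁻¹ := by
    intro y lam hlam
    refine eq_of_eq_on_real (hUhol 0 y) (g := fun z => F y z⁻¹)
      ((hFz y).comp_differentiableOn fun z hz =>
        (differentiableAt_inv hz).differentiableWithinAt) (fun r hr => ?_) hlam
    have := hFu (r : ℂ)⁻¹ (fun y' => U 0 y' r) (fun y' => by
      simpa using (hLax r hr 0 y').2) y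
    simpa [hUinit r hr] using this
  refine ⟨F, hF0, hFd, fun x y lam hlam => ?_⟩
  have hA : ∀ z x, Aphi φ 0 x y + z • ((Complex.I / 2) • !![0, -1; -1, 0]) = Aphi φ z x y := by
    intro z x
    ext i j
    fin_cases i <;> fin_cases j <;> simp [Aphi] <;> ring
  have hA0 : Continuous fun x => Aphi φ 0 x y := by
    have hd : Continuous fun x => deriv (fun x' => φ x' y) x :=
      (hφx y).continuous_deriv (by simp)
    refine Continuous.fun_const_smul ?_ _
    refine continuous_matrix fun i j => ?_
    fin_cases i <;> fin_cases j <;> simp <;> fun_prop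
  obtain ⟨W, V, -, -, hWz, hVz, hWV, hWu⟩ := exists_fundamental_solution hA0
    (continuous_const (y := (Complex.I / 2) • !![0, -1; -1, 0]))
  simp only [hA] at hWu
  have hUW : ∀ z, z ≠ 0 → U x y z = U 0 y z * W x z := by
    intro z hz
    have hdiff : DifferentiableOn ℂ (fun z => F y z⁻¹ * W x z) {0}ᶜ := by
      have hdF : DifferentiableOn ℂ (fun z => F y z⁻¹) {0}ᶜ :=
        (hUhol 0 y).congr fun z hz => (hUF y z hz).symm
      exact hdF.matrix_mul (hWz x).differentiableOn
    rw [hUF y z hz]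
    refine eq_of_eq_on_real (hUhol x y) (g := fun z => F y z⁻¹ * W x z) hdiff
      (fun r hr => ?_) hz
    rw [hWu r (fun x' => U x' y r) (fun x' => (hLax r hr x' y).1) x,
      hUF y r (by exact_mod_cast hr)]
  have hlim : Filter.Tendsto (fun z => F y z⁻¹) (Filter.cocompact ℂ) (nhds 1) := by
    have hF1 : F y 0 = 1 := by
      have h : ∀ t, HasDerivAt (fun s => F s 0) 0 t := fun t => by
        simpa [Bphi] using hFd t 0
      rw [← hF0 0]
      exact is_const_of_deriv_eq_zero (fun t => (h t).differentiableAt)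
        (fun t => (h t).deriv) y 0
    rw [← hF1, ← Metric.cobounded_eq_cocompact]
    exact (hFz y).continuous.continuousAt.tendsto.comp Filter.tendsto_inv₀_cobounded
  refine birkhoff_minus_factor_unique (F := fun z => F y z⁻¹) hlim (hUminf x y).tendsto
    (hUminv x y) (differentiableOn_univ.1
      ((hVphol x y).differentiableOn.matrix_mul (hVz x).differentiableOn)) (fun z hz => ?_) lam hlam
  rw [← mul_assoc, ← hfac x y z hz, hUW z hz, mul_assoc, hWV, mul_one, hUF y z hz]

/-- Birkhoff splitting `U = U₋·V₊` of the extended frame: the negative factor `U₋` does not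
depend on `x`, satisfies `U₋ = I` at `y = 0`, and
`U₋⁻¹·∂_yU₋ = λ⁻¹·(i/2)·[[0, e^{−iφ(0,y)}], [e^{iφ(0,y)}, 0]]`,
which defines the normalized potential `η^y`. -/
theorem birkhoff_minus_factor_normalized_potential_y
    (φ : ℝ → ℝ → ℝ) (hφ : ContDiff ℝ (⊤ : ℕ∞) (fun p : ℝ × ℝ => φ p.1 p.2))
    (hsg : ∀ x y : ℝ, deriv (fun x' => deriv (fun y' => φ x' y') y) x = Real.sin (φ x y))
    (U Um Vp : ℝ → ℝ → ℂ → Matrix (Fin 2) (Fin 2) ℂ)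
    -- the extended frame `U`
    (hUsm : ∀ lam : ℂ, lam ≠ 0 → ContDiff ℝ (⊤ : ℕ∞) (fun p : ℝ × ℝ => U p.1 p.2 lam))
    (hUhol : ∀ x y : ℝ, DifferentiableOn ℂ (U x y) {0}ᶜ)
    (hUtw : ∀ x y : ℝ, ∀ lam : ℂ, lam ≠ 0 → U x y (-lam) = sigma3 * U x y lam * sigma3)
    (hUinv : ∀ x y : ℝ, ∀ lam : ℂ, lam ≠ 0 → IsUnit (U x y lam))
    (hLax : ∀ lam : ℝ, lam ≠ 0 → ∀ x y : ℝ,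
      HasDerivAt (fun x' => U x' y (lam : ℂ)) (U x y (lam : ℂ) * Aphi φ (lam : ℂ) x y) x ∧
      HasDerivAt (fun y' => U x y' (lam : ℂ)) (U x y (lam : ℂ) * Bphi φ (lam : ℂ) x y) y)
    (hUinit : ∀ lam : ℝ, lam ≠ 0 → U 0 0 (lam : ℂ) = 1)
    -- the negative factor `U₋`, holomorphic at `∞` with value `I`
    (hUmsm : ∀ lam : ℂ, lam ≠ 0 → ContDiff ℝ (⊤ : ℕ∞) (fun p : ℝ × ℝ => Um p.1 p.2 lam))
    (hUmhol : ∀ x y : ℝ, DifferentiableOn ℂ (Um x y) {0}ᶜ)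
    (hUmtw : ∀ x y : ℝ, ∀ lam : ℂ, lam ≠ 0 → Um x y (-lam) = sigma3 * Um x y lam * sigma3)
    (hUminv : ∀ x y : ℝ, ∀ lam : ℂ, lam ≠ 0 → IsUnit (Um x y lam))
    (hUminf : ∀ x y : ℝ, HolomAtInfty (Um x y) 1)
    -- the positive factor `V₊`, entire with invertible values
    (hVpsm : ∀ lam : ℂ, ContDiff ℝ (⊤ : ℕ∞) (fun p : ℝ × ℝ => Vp p.1 p.2 lam))
    (hVphol : ∀ x y : ℝ, Differentiable ℂ (Vp x y))
    (hVptw : ∀ x y : ℝ, ∀ lam : ℂ, Vp x y (-lam) = sigma3 * Vp x y lam * sigma3)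
    (hVpinv : ∀ x y : ℝ, ∀ lam : ℂ, IsUnit (Vp x y lam))
    -- the factorization `U = U₋·V₊`
    (hfac : ∀ x y : ℝ, ∀ lam : ℂ, lam ≠ 0 → U x y lam = Um x y lam * Vp x y lam) :
    (∀ x y : ℝ, ∀ lam : ℂ, lam ≠ 0 → deriv (fun x' => Um x' y lam) x = 0) ∧
    (∀ x : ℝ, ∀ lam : ℂ, lam ≠ 0 → Um x 0 lam = 1) ∧
    (∀ x y : ℝ, ∀ lam : ℂ, lam ≠ 0 →
      (Um x y lam)⁻¹ * deriv (fun y' => Um x y' lam) y =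
        lam⁻¹ • ((Complex.I / 2) •
          !![0, Complex.exp (-Complex.I * ((φ 0 y : ℝ) : ℂ));
             Complex.exp (Complex.I * ((φ 0 y : ℝ) : ℂ)), 0])) := by
  obtain ⟨F, hF0, hFd, hUmF⟩ := exists_birkhoff_minus_factor_frame hφ hUhol hLax hUinit hUminv
    hUminf hVphol hfac
  refine ⟨fun x y lam hlam => ?_, fun x lam hlam => ?_, fun x y lam hlam => ?_⟩
  · simp only [hUmF _ _ lam hlam]
    exact deriv_const x _
  · rw [hUmF x 0 lam hlam, hF0]
  · have hdet := (Matrix.isUnit_iff_isUnit_det _).1 (hUminv x y lam hlam)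
    rw [hUmF x y lam hlam] at hdet
    simp only [hUmF x _ lam hlam]
    have hd : deriv (fun y' => F y' lam⁻¹) y = F y lam⁻¹ * Bphi φ lam⁻¹⁻¹ 0 y :=
      (hFd y lam⁻¹).deriv
    rw [hd, Matrix.nonsing_inv_mul_cancel_left _ _ hdet, Bphi, inv_inv, smul_comm]

end
end

section
/- Let a : ℝ → ℝ be smooth and set ξ(x) := (i/2)·[[0, e^{−i·a(x)}], [e^{i·a(x)}, 0]]. For each λ ∈ ℂ let U(·,λ) : ℝ → M₂(ℂ) be the unique solution of the linear ODE ∂ₓU(x,λ) = −λ·U(x,λ)·ξ(x) with U(0,λ) = I. Then: (i) for every real λ and every x ∈ ℝ, U(x,λ) ∈ SU(2); (ii) for every fixed x ∈ ℝ, the map λ ↦ U(x,λ) is entire; (iii) U(x,−λ) = σ₃·U(x,λ)·σ₃ for all x ∈ ℝ and λ ∈ ℂ, i.e., λ ↦ U(x,λ) is twisted. -/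
open Matrix Complex

attribute [local instance] Matrix.normedAddCommGroup Matrix.normedSpace

noncomputable section

/-- The symmetric potential `ξ(x) = (i/2)·[[0, e^{−ia(x)}], [e^{ia(x)}, 0]]`. -/
def symPot (a : ℝ → ℝ) (x : ℝ) : Matrix (Fin 2) (Fin 2) ℂ :=
  (Complex.I / 2) •
    !![0, Complex.exp (-Complex.I * ((a x : ℝ) : ℂ));
       Complex.exp (Complex.I * ((a x : ℝ) : ℂ)), 0]

/-- The product rule for matrix-valued functions of a real variable. -/
theorem hasDerivAt_matrix_mul {P Q : ℝ → Matrix (Fin 2) (Fin 2) ℂ}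
    {P' Q' : Matrix (Fin 2) (Fin 2) ℂ} {x : ℝ}
    (hP : HasDerivAt P P' x) (hQ : HasDerivAt Q Q' x) :
    HasDerivAt (fun t => P t * Q t) (P' * Q x + P x * Q') x := by
  refine hasDerivAt_pi.2 fun i => hasDerivAt_pi.2 fun j => ?_
  have hp (k : Fin 2) : HasDerivAt (fun t => P t i k) (P' i k) x :=
    hasDerivAt_pi.1 (hasDerivAt_pi.1 hP i) k
  have hq (k : Fin 2) : HasDerivAt (fun t => Q t k j) (Q' k j) x :=
    hasDerivAt_pi.1 (hasDerivAt_pi.1 hQ k) j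
  simp only [Matrix.mul_apply, Matrix.add_apply, Fin.sum_univ_two]
  exact (((hp 0).mul (hq 0)).add ((hp 1).mul (hq 1))).congr_deriv (by ring)

theorem hasDerivAt_adjugate {P : ℝ → Matrix (Fin 2) (Fin 2) ℂ}
    {P' : Matrix (Fin 2) (Fin 2) ℂ} {x : ℝ} (hP : HasDerivAt P P' x) :
    HasDerivAt (fun t => (P t).adjugate) P'.adjugate x := by
  have hp (i j : Fin 2) : HasDerivAt (fun t => P t i j) (P' i j) x :=
    hasDerivAt_pi.1 (hasDerivAt_pi.1 hP i) j
  refine hasDerivAt_pi.2 fun i => hasDerivAt_pi.2 fun j => ?_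
  simp only [Matrix.adjugate_fin_two]
  fin_cases i <;> fin_cases j
  · simpa using hp 1 1
  · simpa using (hp 0 1).fun_neg
  · simpa using (hp 1 0).fun_neg
  · simpa using hp 0 0

theorem hasDerivAt_conjTranspose {P : ℝ → Matrix (Fin 2) (Fin 2) ℂ}
    {P' : Matrix (Fin 2) (Fin 2) ℂ} {x : ℝ} (hP : HasDerivAt P P' x) :
    HasDerivAt (fun t => (P t)ᴴ) P'ᴴ x :=
  hasDerivAt_pi.2 fun i => hasDerivAt_pi.2 fun j =>
    (hasDerivAt_pi.1 (hasDerivAt_pi.1 hP j) i).star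

/-- A function of a real variable with vanishing derivative is constant. -/
theorem eq_of_hasDerivAt_zero {f : ℝ → Matrix (Fin 2) (Fin 2) ℂ}
    (hf : ∀ x, HasDerivAt f 0 x) (x y : ℝ) : f x = f y :=
  is_const_of_deriv_eq_zero (fun t => (hf t).differentiableAt) (fun t => (hf t).deriv) x y

theorem adjugate_mul_symPot (a : ℝ → ℝ) (x : ℝ) (A : Matrix (Fin 2) (Fin 2) ℂ) (c : ℂ) :
    (c • (A * symPot a x)).adjugate = (-c) • (symPot a x * A.adjugate) := by
  ext i j
  fin_cases i <;> fin_cases j <;>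
    simp [symPot, Matrix.adjugate_fin_two, Matrix.mul_apply, Fin.sum_univ_two,
      -mul_eq_mul_left_iff] <;> ring

theorem conjTranspose_symPot (a : ℝ → ℝ) (x : ℝ) : (symPot a x)ᴴ = -symPot a x := by
  have h1 : (starRingEnd ℂ) (Complex.exp (-Complex.I * (a x : ℂ))) =
      Complex.exp (Complex.I * (a x : ℂ)) := by
    rw [← Complex.exp_conj]; simp
  have h2 : (starRingEnd ℂ) (Complex.exp (Complex.I * (a x : ℂ))) =
      Complex.exp (-Complex.I * (a x : ℂ)) := by
    rw [← Complex.exp_conj]; simp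
  ext i j
  fin_cases i <;> fin_cases j
  · simp [symPot]
  · simp [symPot, -neg_mul, h2]; ring
  · simp [symPot, -neg_mul, h1]; ring
  · simp [symPot]

theorem symPot_mul_sigma3 (a : ℝ → ℝ) (x : ℝ) :
    symPot a x * sigma3 = -(sigma3 * symPot a x) := by
  ext i j
  fin_cases i <;> fin_cases j <;> simp [symPot, sigma3]

theorem sigma3_mul_self : sigma3 * sigma3 = 1 := by
  ext i j
  fin_cases i <;> fin_cases j <;> simp [sigma3]

theorem continuous_symPot {a : ℝ → ℝ} (ha : Continuous a) : Continuous (symPot a) := by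
  refine continuous_matrix fun i j => ?_
  fin_cases i <;> fin_cases j <;> simp [symPot] <;> fun_prop

theorem norm_mul_symPot_le (a : ℝ → ℝ) (x : ℝ) (A : Matrix (Fin 2) (Fin 2) ℂ) :
    ‖A * symPot a x‖ ≤ ‖A‖ := by
  have h1 : ‖Complex.exp (-Complex.I * (a x : ℂ))‖ = 1 := by
    rw [Complex.norm_exp]; simp
  have h2 : ‖Complex.exp (Complex.I * (a x : ℂ))‖ = 1 := by
    rw [Complex.norm_exp]; simp
  have hA (i j : Fin 2) := A.norm_entry_le_entrywise_sup_norm (i := i) (j := j)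
  have hA0 := norm_nonneg A
  refine (Matrix.norm_le_iff hA0).2 fun i j => ?_
  fin_cases j
  · simp [symPot, Matrix.mul_apply, Fin.sum_univ_two, -neg_mul, h2]
    linarith [hA i 1]
  · simp [symPot, Matrix.mul_apply, Fin.sum_univ_two, -neg_mul, h1]
    linarith [hA i 0]

theorem norm_mul_le_two_mul (A B : Matrix (Fin 2) (Fin 2) ℂ) : ‖A * B‖ ≤ 2 * (‖A‖ * ‖B‖) := by
  refine (Matrix.norm_le_iff (by positivity)).2 fun i j => ?_
  rw [Matrix.mul_apply, Fin.sum_univ_two, two_mul]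
  refine norm_add_le_of_le ?_ ?_ <;> rw [norm_mul] <;> gcongr <;>
    exact Matrix.norm_entry_le_entrywise_sup_norm _

theorem norm_adjugate_le (A : Matrix (Fin 2) (Fin 2) ℂ) : ‖A.adjugate‖ ≤ ‖A‖ := by
  refine (Matrix.norm_le_iff (norm_nonneg A)).2 fun i j => ?_
  rw [Matrix.adjugate_fin_two]
  fin_cases i <;> fin_cases j <;> simp <;> exact A.norm_entry_le_entrywise_sup_norm

/-- Grönwall's inequality on the whole line. -/
theorem norm_le_mul_exp_mul_abs {E : Type*} [NormedAddCommGroup E] [NormedSpace ℝ E]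
    {f f' : ℝ → E} {K : ℝ} (hf : ∀ t, HasDerivAt f (f' t) t) (hK : ∀ t, ‖f' t‖ ≤ K * ‖f t‖)
    (x : ℝ) : ‖f x‖ ≤ ‖f 0‖ * Real.exp (K * |x|) := by
  have key {g g' : ℝ → E} (hg : ∀ t, HasDerivAt g (g' t) t) (hK : ∀ t, ‖g' t‖ ≤ K * ‖g t‖)
      (y : ℝ) (hy : 0 ≤ y) : ‖g y‖ ≤ ‖g 0‖ * Real.exp (K * y) := by
    have := norm_le_gronwallBound_of_norm_deriv_right_le (f := g) (f' := g') (δ := ‖g 0‖)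
      (K := K) (ε := 0) (a := 0) (b := y)
      (fun t _ => (hg t).continuousAt.continuousWithinAt)
      (fun t _ => (hg t).hasDerivWithinAt) le_rfl (fun t _ => by simpa using hK t) y ⟨hy, le_rfl⟩
    simpa [gronwallBound_ε0] using this
  rcases le_total 0 x with hx | hx
  · simpa [abs_of_nonneg hx] using key hf hK x hx
  · have hg (t : ℝ) : HasDerivAt (fun s => f (-s)) (-f' (-t)) t := by
      simpa [Function.comp_def] using (hf (-t)).scomp t (hasDerivAt_neg t)
    simpa [abs_of_nonpos hx] using
      key hg (fun t => by simpa using hK (-t)) (-x) (by linarith)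

/-- The key identity: if `P' = αPξ` and `Q' = βQξ` then `(P adj Q)' = (α - β) P ξ adj Q`. -/
theorem hasDerivAt_mul_adjugate {a : ℝ → ℝ} {P Q : ℝ → Matrix (Fin 2) (Fin 2) ℂ} {α β : ℂ} {x : ℝ}
    (hP : HasDerivAt P (α • (P x * symPot a x)) x)
    (hQ : HasDerivAt Q (β • (Q x * symPot a x)) x) :
    HasDerivAt (fun t => P t * (Q t).adjugate)
      ((α - β) • (P x * symPot a x * (Q x).adjugate)) x := by
  refine (hasDerivAt_matrix_mul hP (hasDerivAt_adjugate hQ)).congr_deriv ?_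
  rw [adjugate_mul_symPot, Matrix.smul_mul, Matrix.mul_smul, ← Matrix.mul_assoc, ← add_smul,
    sub_eq_add_neg]

theorem det_eq_one_of_symPot_ode {a : ℝ → ℝ} {P : ℝ → Matrix (Fin 2) (Fin 2) ℂ} {α : ℂ}
    (hP : ∀ x, HasDerivAt P (α • (P x * symPot a x)) x) (h0 : P 0 = 1) (x : ℝ) :
    (P x).det = 1 := by
  have h := eq_of_hasDerivAt_zero
    (fun t => (hasDerivAt_mul_adjugate (hP t) (hP t)).congr_deriv (by simp)) x 0
  simp only [Matrix.mul_adjugate, h0, Matrix.det_one, one_smul] at h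
  simpa using congrFun (congrFun h 0) 0

theorem eq_of_symPot_ode {a : ℝ → ℝ} {P Q : ℝ → Matrix (Fin 2) (Fin 2) ℂ} {α : ℂ}
    (hP : ∀ x, HasDerivAt P (α • (P x * symPot a x)) x) (hP0 : P 0 = 1)
    (hQ : ∀ x, HasDerivAt Q (α • (Q x * symPot a x)) x) (hQ0 : Q 0 = 1) (x : ℝ) :
    P x = Q x := by
  have h := eq_of_hasDerivAt_zero
    (fun t => (hasDerivAt_mul_adjugate (hP t) (hQ t)).congr_deriv (by simp)) x 0
  simp only [hP0, hQ0, Matrix.adjugate_one, Matrix.mul_one] at h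
  calc P x = P x * ((Q x).adjugate * Q x) := by
        rw [Matrix.adjugate_mul, det_eq_one_of_symPot_ode hQ hQ0, one_smul, Matrix.mul_one]
    _ = Q x := by rw [← Matrix.mul_assoc, h, Matrix.one_mul]

theorem mul_conjTranspose_eq_one_of_symPot_ode {a : ℝ → ℝ}
    {P : ℝ → Matrix (Fin 2) (Fin 2) ℂ} {r : ℝ}
    (hP : ∀ x, HasDerivAt P ((r : ℂ) • (P x * symPot a x)) x) (h0 : P 0 = 1) (x : ℝ) :
    P x * (P x)ᴴ = 1 := by
  have h := eq_of_hasDerivAt_zero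
    (fun t => (hasDerivAt_matrix_mul (hP t) (hasDerivAt_conjTranspose (hP t))).congr_deriv (by
      simp [Matrix.conjTranspose_smul, conjTranspose_symPot, Matrix.mul_assoc])) x 0
  simpa [h0] using h

theorem norm_le_exp_of_symPot_ode {a : ℝ → ℝ} {P : ℝ → Matrix (Fin 2) (Fin 2) ℂ} {α : ℂ}
    (hP : ∀ x, HasDerivAt P (α • (P x * symPot a x)) x) (h0 : P 0 = 1) (x : ℝ) :
    ‖P x‖ ≤ Real.exp (‖α‖ * |x|) := by
  have h1 : ‖(1 : Matrix (Fin 2) (Fin 2) ℂ)‖ ≤ 1 := by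
    refine (Matrix.norm_le_iff zero_le_one).2 fun i j => ?_
    fin_cases i <;> fin_cases j <;> simp
  have h := norm_le_mul_exp_mul_abs (K := ‖α‖) hP (fun t => by
    rw [norm_smul]
    gcongr
    exact norm_mul_symPot_le a t _) x
  rw [h0] at h
  exact h.trans (mul_le_of_le_one_left (Real.exp_pos _).le h1)

/-- Variation of constants: the difference of two solutions with different parameters. -/
theorem sub_eq_smul_integral_of_symPot_ode {a : ℝ → ℝ} (ha : Continuous a)
    {P Q : ℝ → Matrix (Fin 2) (Fin 2) ℂ} {α β : ℂ}
    (hP : ∀ x, HasDerivAt P (α • (P x * symPot a x)) x) (hP0 : P 0 = 1)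
    (hQ : ∀ x, HasDerivAt Q (β • (Q x * symPot a x)) x) (hQ0 : Q 0 = 1) (x : ℝ) :
    P x - Q x = (α - β) • ((∫ t in (0 : ℝ)..x, P t * symPot a t * (Q t).adjugate) * Q x) := by
  have hPc : Continuous P := continuous_iff_continuousAt.2 fun t => (hP t).continuousAt
  have hQc : Continuous Q := continuous_iff_continuousAt.2 fun t => (hQ t).continuousAt
  have hc : Continuous fun t => (α - β) • (P t * symPot a t * (Q t).adjugate) :=
    (((hPc.matrix_mul (continuous_symPot ha)).matrix_mul hQc.matrix_adjugate).const_smul (α - β))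
  have h := intervalIntegral.integral_eq_sub_of_hasDerivAt (a := 0) (b := x)
    (fun t _ => hasDerivAt_mul_adjugate (hP t) (hQ t)) (hc.intervalIntegrable 0 x)
  rw [intervalIntegral.integral_smul] at h
  rw [← Matrix.smul_mul, h, hP0, hQ0, Matrix.adjugate_one, Matrix.mul_one, Matrix.sub_mul,
    Matrix.mul_assoc, Matrix.adjugate_mul, det_eq_one_of_symPot_ode hQ hQ0, one_smul,
    Matrix.mul_one, Matrix.one_mul]

/-- Solutions of the linear ODE depend holomorphically on the parameter. -/
theorem hasDerivAt_param_of_symPot_ode {a : ℝ → ℝ} (ha : Continuous a)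
    {U : ℝ → ℂ → Matrix (Fin 2) (Fin 2) ℂ}
    (hode : ∀ lam : ℂ, ∀ x : ℝ,
      HasDerivAt (fun x' => U x' lam) ((-lam) • (U x lam * symPot a x)) x)
    (hinit : ∀ lam : ℂ, U 0 lam = 1) (x : ℝ) (lam : ℂ) :
    HasDerivAt (fun mu => U x mu)
      (-((∫ t in (0 : ℝ)..x, U t lam * symPot a t * (U t lam).adjugate) * U x lam)) lam := by
  let F : ℂ → ℝ → Matrix (Fin 2) (Fin 2) ℂ :=
    fun mu t => U t mu * symPot a t * (U t lam).adjugate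
  let bound : ℝ → ℝ := fun t => 2 * (Real.exp ((‖lam‖ + 1) * |t|) * Real.exp (‖lam‖ * |t|))
  have hUc (mu : ℂ) : Continuous fun t => U t mu :=
    continuous_iff_continuousAt.2 fun t => (hode mu t).continuousAt
  have hFc (mu : ℂ) : Continuous (F mu) :=
    ((hUc mu).matrix_mul (continuous_symPot ha)).matrix_mul (hUc lam).matrix_adjugate
  have hbc : Continuous bound := by fun_prop
  have hball : ∀ᶠ mu in nhds lam, ‖mu‖ ≤ ‖lam‖ + 1 := by
    filter_upwards [Metric.ball_mem_nhds lam one_pos] with mu hmu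
    rw [mem_ball_iff_norm] at hmu
    linarith [norm_sub_norm_le mu lam]
  have hbound : ∀ᶠ mu in nhds lam, ∀ t, ‖F mu t‖ ≤ bound t := by
    filter_upwards [hball] with mu hmu t
    refine (norm_mul_le_two_mul _ _).trans ?_
    have h1 : ‖U t mu * symPot a t‖ ≤ Real.exp ((‖lam‖ + 1) * |t|) := by
      refine ((norm_mul_symPot_le a t _).trans
        (norm_le_exp_of_symPot_ode (hode mu) (hinit mu) t)).trans ?_
      rw [norm_neg]
      gcongr
    have h2 : ‖(U t lam).adjugate‖ ≤ Real.exp (‖lam‖ * |t|) := by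
      refine (norm_adjugate_le _).trans ?_
      simpa using norm_le_exp_of_symPot_ode (hode lam) (hinit lam) t
    simp only [bound]
    gcongr
  have hsub (t : ℝ) (mu : ℂ) :
      U t mu - U t lam = (lam - mu) • ((∫ s in (0 : ℝ)..t, F mu s) * U t lam) := by
    rw [sub_eq_smul_integral_of_symPot_ode ha (hode mu) (hinit mu) (hode lam) (hinit lam) t,
      neg_sub_neg]
  have hUcont (t : ℝ) : ContinuousAt (fun mu => U t mu) lam := by
    have hbd : ∀ᶠ mu in nhds lam, ‖(∫ s in (0 : ℝ)..t, F mu s) * U t lam‖ ≤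
        2 * (|∫ s in (0 : ℝ)..t, bound s| * ‖U t lam‖) := by
      filter_upwards [hbound] with mu hmu
      refine (norm_mul_le_two_mul _ _).trans ?_
      gcongr
      exact intervalIntegral.norm_integral_le_abs_of_norm_le
        (MeasureTheory.ae_of_all _ fun s => hmu s) (hbc.intervalIntegrable 0 t)
    have h0 : Filter.Tendsto (fun mu : ℂ => lam - mu) (nhds lam) (nhds 0) := by
      have : Continuous fun mu : ℂ => lam - mu := by fun_prop
      simpa using this.tendsto lam
    refine tendsto_sub_nhds_zero_iff.1 ?_
    simp only [hsub]
    exact h0.zero_smul_isBoundedUnder_le ⟨_, hbd⟩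
  have hmul (B : Matrix (Fin 2) (Fin 2) ℂ) :
      Continuous fun A : Matrix (Fin 2) (Fin 2) ℂ => A * B :=
    continuous_id.matrix_mul continuous_const
  have hI : ContinuousAt (fun mu => ∫ t in (0 : ℝ)..x, F mu t) lam := by
    refine intervalIntegral.continuousAt_of_dominated_interval (bound := bound)
      (Filter.Eventually.of_forall fun mu =>
        ((hFc mu).intervalIntegrable 0 x).def'.aestronglyMeasurable)
      (hbound.mono fun mu hmu => MeasureTheory.ae_of_all _ fun t _ => hmu t)
      (hbc.intervalIntegrable 0 x) (MeasureTheory.ae_of_all _ fun t _ => ?_)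
    exact (hmul _).continuousAt.comp ((hmul _).continuousAt.comp (hUcont t))
  refine hasDerivAt_iff_tendsto_slope.2 ?_
  have hlim : Filter.Tendsto (fun mu => -((∫ t in (0 : ℝ)..x, F mu t) * U x lam))
      (nhdsWithin lam {lam}ᶜ)
      (nhds (-((∫ t in (0 : ℝ)..x, F lam t) * U x lam))) :=
    ((hmul _).continuousAt.comp hI).neg.tendsto.mono_left nhdsWithin_le_nhds
  refine hlim.congr' ?_
  filter_upwards [self_mem_nhdsWithin] with mu hmu
  have hne : mu - lam ≠ 0 := sub_ne_zero.2 hmu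
  rw [slope_def_module, hsub, smul_smul, ← neg_sub mu lam, mul_neg, inv_mul_cancel₀ hne, neg_smul,
    one_smul]

/-- The solution `U(·,λ)` of the linear ODE `∂ₓU = −λ·U·ξ`, `U(0,λ) = I`, with symmetric
potential `ξ` determined by a smooth real function `a`, takes values in SU(2) for real `λ`,
is entire in `λ`, and is twisted: `U(x,−λ) = σ₃·U(x,λ)·σ₃`. -/
theorem symmetric_potential_ode_solution_properties
    (a : ℝ → ℝ) (ha : ContDiff ℝ (⊤ : ℕ∞) a)
    (U : ℝ → ℂ → Matrix (Fin 2) (Fin 2) ℂ)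
    (hode : ∀ lam : ℂ, ∀ x : ℝ,
      HasDerivAt (fun x' => U x' lam) ((-lam) • (U x lam * symPot a x)) x)
    (hinit : ∀ lam : ℂ, U 0 lam = 1) :
    (∀ lam : ℝ, ∀ x : ℝ, IsSU2 (U x (lam : ℂ))) ∧
    (∀ x : ℝ, Differentiable ℂ (fun lam => U x lam)) ∧
    (∀ x : ℝ, ∀ lam : ℂ, U x (-lam) = sigma3 * U x lam * sigma3) := by
  refine ⟨fun lam x => ⟨?_, det_eq_one_of_symPot_ode (hode lam) (hinit lam) x⟩,
    fun x lam => (hasDerivAt_param_of_symPot_ode ha.continuous hode hinit x lam).differentiableAt,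
    fun x lam => ?_⟩
  · refine mul_conjTranspose_eq_one_of_symPot_ode (a := a) (r := -lam) (P := fun t => U t lam)
      (fun t => ?_) (hinit lam) x
    simpa using hode lam t
  · refine eq_of_symPot_ode (Q := fun t => sigma3 * U t lam * sigma3) (hode (-lam)) (hinit _)
      (fun t => ?_) (by simp [hinit, sigma3_mul_self]) x
    have h := hasDerivAt_matrix_mul
      (hasDerivAt_matrix_mul (hasDerivAt_const t sigma3) (hode lam t)) (hasDerivAt_const t sigma3)
    refine h.congr_deriv ?_
    simp only [Matrix.zero_mul, zero_add, Matrix.mul_zero, add_zero, neg_neg, Matrix.mul_smul,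
      Matrix.smul_mul, Matrix.mul_assoc, symPot_mul_sigma3, Matrix.mul_neg, smul_neg, neg_smul, Matrix.neg_mul]

end
end

section
/- Let D̃ = I×J with I, J ⊆ ℝ open intervals containing 0. Let U, V₋ : D̃×(ℂ∖{0}) → GL₂(ℂ) and U₊ : D̃×ℂ → GL₂(ℂ) be smooth in (x,y) and holomorphic in λ, with U₊ entire and twisted satisfying U₊(x,y,0) = I, V₋ twisted and holomorphic at ∞ with invertible value, and U = U₊·V₋. Let R : D̃ → SU(2) be smooth with diagonal values, put R₀ := R(0,0), and define the gauged frame Û(x,y,λ) := R₀⁻¹·U(x,y,λ)·R(x,y). If Û = Û₊·V̂₋ is any factorization with the same properties (Û₊ smooth in (x,y), entire and twisted in λ, invertible values, Û₊(x,y,0) = I; V̂₋ smooth in (x,y), holomorphic and twisted in λ, invertible values, holomorphic at ∞ with invertible value), then Û₊ = R₀⁻¹·U₊·R₀ and hence Û₊⁻¹·∂ₓÛ₊ = R₀⁻¹·(U₊⁻¹·∂ₓU₊)·R₀, i.e., the potential of the gauged frame is the conjugate η̂^x = R₀⁻¹·η^x·R₀. Analogously, if U = U₋·V₊ with U₋ smooth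 in (x,y), holomorphic and twisted in λ, holomorphic at ∞ with value I, invertible values, and V₊ smooth in (x,y), entire and twisted, invertible values, and if Û = Û₋·V̂₊ is a factorization of the gauged frame with the same properties, then Û₋ = R₀⁻¹·U₋·R₀ and Û₋⁻¹·∂_yÛ₋ = R₀⁻¹·(U₋⁻¹·∂_yU₋)·R₀, i.e., η̂^y = R₀⁻¹·η^y·R₀. -/
open Matrix Complex

attribute [local instance] Matrix.normedAddCommGroup Matrix.normedSpace

noncomputable section

/-- A positive loop factor on the rectangle `I × J`, normalized by `F(x,y,0) = I`:
smooth in `(x,y)`, entire and twisted in `λ`, with invertible values. -/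
def IsPlusFactor (I J : Set ℝ) (F : ℝ → ℝ → ℂ → Matrix (Fin 2) (Fin 2) ℂ) : Prop :=
  (∀ lam : ℂ, ContDiffOn ℝ (⊤ : ℕ∞) (fun p : ℝ × ℝ => F p.1 p.2 lam) (I ×ˢ J)) ∧
  ∀ x ∈ I, ∀ y ∈ J,
    Differentiable ℂ (F x y) ∧
    (∀ lam : ℂ, F x y (-lam) = sigma3 * F x y lam * sigma3) ∧
    (∀ lam : ℂ, IsUnit (F x y lam)) ∧
    F x y 0 = 1

/-- A positive loop factor on `I × J` without normalization at `λ = 0`. -/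
def IsPlusFactorGen (I J : Set ℝ) (F : ℝ → ℝ → ℂ → Matrix (Fin 2) (Fin 2) ℂ) : Prop :=
  (∀ lam : ℂ, ContDiffOn ℝ (⊤ : ℕ∞) (fun p : ℝ × ℝ => F p.1 p.2 lam) (I ×ˢ J)) ∧
  ∀ x ∈ I, ∀ y ∈ J,
    Differentiable ℂ (F x y) ∧
    (∀ lam : ℂ, F x y (-lam) = sigma3 * F x y lam * sigma3) ∧
    (∀ lam : ℂ, IsUnit (F x y lam))

/-- A negative loop factor on `I × J`: smooth in `(x,y)`, holomorphic and twisted in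
`λ ∈ ℂ∖{0}`, invertible values, holomorphic at `∞` with invertible value there. -/
def IsMinusFactorInv (I J : Set ℝ) (F : ℝ → ℝ → ℂ → Matrix (Fin 2) (Fin 2) ℂ) : Prop :=
  (∀ lam : ℂ, lam ≠ 0 → ContDiffOn ℝ (⊤ : ℕ∞) (fun p : ℝ × ℝ => F p.1 p.2 lam) (I ×ˢ J)) ∧
  ∀ x ∈ I, ∀ y ∈ J,
    DifferentiableOn ℂ (F x y) {0}ᶜ ∧
    (∀ lam : ℂ, lam ≠ 0 → F x y (-lam) = sigma3 * F x y lam * sigma3) ∧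
    (∀ lam : ℂ, lam ≠ 0 → IsUnit (F x y lam)) ∧
    (∃ L : Matrix (Fin 2) (Fin 2) ℂ, IsUnit L ∧ HolomAtInfty (F x y) L)

/-- A negative loop factor on `I × J` normalized to `I` at `∞`. -/
def IsMinusFactorOne (I J : Set ℝ) (F : ℝ → ℝ → ℂ → Matrix (Fin 2) (Fin 2) ℂ) : Prop :=
  (∀ lam : ℂ, lam ≠ 0 → ContDiffOn ℝ (⊤ : ℕ∞) (fun p : ℝ × ℝ => F p.1 p.2 lam) (I ×ˢ J)) ∧
  ∀ x ∈ I, ∀ y ∈ J,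
    DifferentiableOn ℂ (F x y) {0}ᶜ ∧
    (∀ lam : ℂ, lam ≠ 0 → F x y (-lam) = sigma3 * F x y lam * sigma3) ∧
    (∀ lam : ℂ, lam ≠ 0 → IsUnit (F x y lam)) ∧
    HolomAtInfty (F x y) 1

/-- Inversion of 2×2 matrices is continuous along a limit with invertible value. -/
lemma tendsto_inv_of_isUnit {α : Type*} {l : Filter α} {f : α → Matrix (Fin 2) (Fin 2) ℂ}
    {L : Matrix (Fin 2) (Fin 2) ℂ} (hf : Filter.Tendsto f l (nhds L)) (hL : IsUnit L) :
    Filter.Tendsto (fun a => (f a)⁻¹) l (nhds L⁻¹) := by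
  have hdet : L.det ≠ 0 := ((Matrix.isUnit_iff_isUnit_det _).1 hL).ne_zero
  have h1 : Filter.Tendsto (fun a => (f a).det) l (nhds L.det) :=
    (continuous_id.matrix_det.tendsto L).comp hf
  have h2 : Filter.Tendsto (fun a => (f a).adjugate) l (nhds L.adjugate) :=
    (continuous_id.matrix_adjugate.tendsto L).comp hf
  simpa only [Matrix.inv_def, Ring.inverse_eq_inv'] using (h1.inv₀ hdet).smul h2

lemma differentiable_matrix_mul {f g : ℂ → Matrix (Fin 2) (Fin 2) ℂ}
    (hf : Differentiable ℂ f) (hg : Differentiable ℂ g) :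
    Differentiable ℂ (fun z => f z * g z) := by
  have hf' : ∀ i j, Differentiable ℂ (fun z => f z i j) := fun i j =>
    differentiable_pi.1 (differentiable_pi.1 hf i) j
  have hg' : ∀ i j, Differentiable ℂ (fun z => g z i j) := fun i j =>
    differentiable_pi.1 (differentiable_pi.1 hg i) j
  refine differentiable_pi.2 fun i => differentiable_pi.2 fun j => ?_
  simp only [Matrix.mul_apply]
  exact Differentiable.fun_sum fun k _ => (hf' i k).mul (hg' k j)

lemma differentiable_matrix_inv {f : ℂ → Matrix (Fin 2) (Fin 2) ℂ}
    (hf : Differentiable ℂ f) (hu : ∀ z, IsUnit (f z)) :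
    Differentiable ℂ (fun z => (f z)⁻¹) := by
  have hf' : ∀ i j, Differentiable ℂ (fun z => f z i j) := fun i j =>
    differentiable_pi.1 (differentiable_pi.1 hf i) j
  have hdet : ∀ z, f z 0 0 * f z 1 1 - f z 0 1 * f z 1 0 ≠ 0 := fun z => by
    rw [← Matrix.det_fin_two]
    exact ((Matrix.isUnit_iff_isUnit_det _).1 (hu z)).ne_zero
  have hd : Differentiable ℂ
      (fun z => (f z 0 0 * f z 1 1 - f z 0 1 * f z 1 0)⁻¹) :=
    (((hf' 0 0).mul (hf' 1 1)).sub ((hf' 0 1).mul (hf' 1 0))).inv hdet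
  refine differentiable_pi.2 fun i => differentiable_pi.2 fun j => ?_
  simp only [Matrix.inv_def, Ring.inverse_eq_inv', Matrix.det_fin_two, Matrix.adjugate_fin_two,
    Matrix.smul_apply, smul_eq_mul]
  refine hd.mul ?_
  fin_cases i <;> fin_cases j <;> simp [hf']

lemma HolomAtInfty.tendsto_cocompact {g : ℂ → Matrix (Fin 2) (Fin 2) ℂ}
    {L : Matrix (Fin 2) (Fin 2) ℂ} (h : HolomAtInfty g L) :
    Filter.Tendsto g (Filter.cocompact ℂ) (nhds L) := by
  obtain ⟨G, hG, rfl, hGg⟩ := h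
  have h0 : Filter.Tendsto (fun z : ℂ => z⁻¹) (Filter.cocompact ℂ) (nhds 0) :=
    Metric.cobounded_eq_cocompact (α := ℂ) ▸ Filter.tendsto_inv₀_cobounded
  refine (hG.continuousAt.tendsto.comp h0).congr' ?_
  filter_upwards [(isCompact_singleton (x := (0 : ℂ))).compl_mem_cocompact] with z hz
  have hz' : z ≠ 0 := hz
  simp [hGg _ (inv_ne_zero hz')]

/-- Uniqueness in the Birkhoff factorization: if `A·P = B·N` off `0`, with `A`, `B` entire,
`A` and `N` invertible, `P` and `N` convergent at `∞`, `N` to an invertible limit, then `A⁻¹·B`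
is constant. -/
lemma inv_mul_eq_of_factorizations {A B P N : ℂ → Matrix (Fin 2) (Fin 2) ℂ}
    {K L : Matrix (Fin 2) (Fin 2) ℂ}
    (hA : Differentiable ℂ A) (hB : Differentiable ℂ B) (hAu : ∀ z, IsUnit (A z))
    (hNu : ∀ z, z ≠ 0 → IsUnit (N z))
    (hP : Filter.Tendsto P (Filter.cocompact ℂ) (nhds K))
    (hN : Filter.Tendsto N (Filter.cocompact ℂ) (nhds L)) (hL : IsUnit L)
    (h : ∀ z, z ≠ 0 → A z * P z = B z * N z) (z : ℂ) :
    (A z)⁻¹ * B z = K * L⁻¹ := by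
  refine (differentiable_matrix_mul (differentiable_matrix_inv hA hAu) hB
    ).apply_eq_of_tendsto_cocompact z ?_
  refine (hP.mul (tendsto_inv_of_isUnit hN hL)).congr' ?_
  filter_upwards [(isCompact_singleton (x := (0 : ℂ))).compl_mem_cocompact] with w hw
  have hAw := (Matrix.isUnit_iff_isUnit_det _).1 (hAu w)
  have hNw := (Matrix.isUnit_iff_isUnit_det _).1 (hNu w hw)
  calc P w * (N w)⁻¹ = (A w)⁻¹ * (A w * P w) * (N w)⁻¹ := by
        rw [Matrix.nonsing_inv_mul_cancel_left _ _ hAw]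
    _ = (A w)⁻¹ * B w := by
        rw [h w hw, ← Matrix.mul_assoc, Matrix.mul_nonsing_inv_cancel_right _ _ hNw]

/-- Conjugation by a constant matrix passes to the logarithmic derivative. -/
lemma inv_mul_deriv_conj {f g : ℝ → Matrix (Fin 2) (Fin 2) ℂ} {S : Matrix (Fin 2) (Fin 2) ℂ}
    {t : ℝ} (hS : IsUnit S.det) (hf : DifferentiableAt ℝ f t)
    (h : g =ᶠ[nhds t] fun s => S⁻¹ * f s * S) :
    (g t)⁻¹ * deriv g t = S⁻¹ * ((f t)⁻¹ * deriv f t) * S := by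
  let T : Matrix (Fin 2) (Fin 2) ℂ →L[ℝ] Matrix (Fin 2) (Fin 2) ℂ :=
    LinearMap.toContinuousLinearMap
      ((LinearMap.mulRight ℝ S).comp (LinearMap.mulLeft ℝ S⁻¹))
  have hT : HasDerivAt (fun s => S⁻¹ * f s * S) (S⁻¹ * deriv f t * S) t :=
    T.hasFDerivAt.comp_hasDerivAt t hf.hasDerivAt
  have hg : deriv g t = S⁻¹ * deriv f t * S := h.deriv_eq.trans hT.deriv
  rw [hg, h.self_of_nhds, Matrix.mul_inv_rev, Matrix.mul_inv_rev,
    Matrix.nonsing_inv_nonsing_inv _ hS]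
  simp only [Matrix.mul_assoc]
  rw [Matrix.mul_nonsing_inv_cancel_left _ _ hS]

lemma IsSU2.isUnit_det {g : Matrix (Fin 2) (Fin 2) ℂ} (h : IsSU2 g) : IsUnit g.det := by
  simp [h.2]

lemma matrix_eq_of_inv_mul_eq_one {X Y : Matrix (Fin 2) (Fin 2) ℂ} (hX : IsUnit X)
    (h : X⁻¹ * Y = 1) : Y = X := by
  rw [← Matrix.mul_nonsing_inv_cancel_left X Y ((Matrix.isUnit_iff_isUnit_det _).1 hX), h, mul_one]

lemma isUnit_conj {S X : Matrix (Fin 2) (Fin 2) ℂ} (hS : IsUnit S.det) (hX : IsUnit X) :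
    IsUnit (S⁻¹ * X * S) :=
  (((Matrix.isUnit_nonsing_inv_iff.2 ((Matrix.isUnit_iff_isUnit_det _).2 hS))).mul hX).mul
    ((Matrix.isUnit_iff_isUnit_det _).2 hS)

/-- Gauging the frame by `R` conjugates its positive Birkhoff factor. -/
lemma gauged_plusFactor {I J : Set ℝ}
    {Up Vm hatUp hatVm : ℝ → ℝ → ℂ → Matrix (Fin 2) (Fin 2) ℂ}
    {S Q : Matrix (Fin 2) (Fin 2) ℂ} {x y : ℝ} (hx : x ∈ I) (hy : y ∈ J)
    (hS : IsUnit S.det)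
    (hUp : IsPlusFactor I J Up) (hVm : IsMinusFactorInv I J Vm)
    (hhatUp : IsPlusFactor I J hatUp) (hhatVm : IsMinusFactorInv I J hatVm)
    (hfac : ∀ lam : ℂ, lam ≠ 0 →
      S⁻¹ * (Up x y lam * Vm x y lam) * Q = hatUp x y lam * hatVm x y lam) (lam : ℂ) :
    hatUp x y lam = S⁻¹ * Up x y lam * S := by
  obtain ⟨hUd, -, hUu, hU0⟩ := hUp.2 x hx y hy
  obtain ⟨-, -, -, K, -, hK⟩ := hVm.2 x hx y hy
  obtain ⟨hUd', -, hUu', hU0'⟩ := hhatUp.2 x hx y hy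
  obtain ⟨-, -, hVu', L, hLu, hL⟩ := hhatVm.2 x hx y hy
  have hconst := inv_mul_eq_of_factorizations
    (A := fun z => S⁻¹ * Up x y z * S) (P := fun z => S⁻¹ * Vm x y z * Q)
    (differentiable_matrix_mul (differentiable_matrix_mul (differentiable_const _) hUd)
      (differentiable_const _))
    hUd' (fun z => isUnit_conj hS (hUu z)) hVu'
    ((hK.tendsto_cocompact.const_mul S⁻¹).mul_const Q) hL.tendsto_cocompact hLu
    (fun z hz => by
      rw [← hfac z hz]
      simp only [Matrix.mul_assoc]
      rw [Matrix.mul_nonsing_inv_cancel_left _ _ hS])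
  have h0 := hconst 0
  simp only [hU0, hU0', mul_one, Matrix.nonsing_inv_mul _ hS, inv_one] at h0
  exact matrix_eq_of_inv_mul_eq_one (isUnit_conj hS (hUu lam)) ((hconst lam).trans h0.symm)

/-- Gauging the frame by `R` conjugates its normalized negative Birkhoff factor. -/
lemma gauged_minusFactor {I J : Set ℝ}
    {Um Vp hatUm hatVp : ℝ → ℝ → ℂ → Matrix (Fin 2) (Fin 2) ℂ}
    {S Q : Matrix (Fin 2) (Fin 2) ℂ} {x y : ℝ} (hx : x ∈ I) (hy : y ∈ J)
    (hS : IsUnit S.det) (hQ : IsUnit Q.det)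
    (hUm : IsMinusFactorOne I J Um) (hVp : IsPlusFactorGen I J Vp)
    (hhatUm : IsMinusFactorOne I J hatUm) (hhatVp : IsPlusFactorGen I J hatVp)
    (hfac : ∀ lam : ℂ, lam ≠ 0 →
      S⁻¹ * (Um x y lam * Vp x y lam) * Q = hatUm x y lam * hatVp x y lam)
    {lam : ℂ} (hlam : lam ≠ 0) :
    hatUm x y lam = S⁻¹ * Um x y lam * S := by
  obtain ⟨-, -, hUu, hU1⟩ := hUm.2 x hx y hy
  obtain ⟨hVd, -, hVu⟩ := hVp.2 x hx y hy
  obtain ⟨-, -, hUu', hU1'⟩ := hhatUm.2 x hx y hy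
  obtain ⟨hVd', -, hVu'⟩ := hhatVp.2 x hx y hy
  have hV : ∀ z, IsUnit (S⁻¹ * Vp x y z * Q) := fun z =>
    ((Matrix.isUnit_nonsing_inv_iff.2 ((Matrix.isUnit_iff_isUnit_det _).2 hS)).mul (hVu z)).mul
      ((Matrix.isUnit_iff_isUnit_det _).2 hQ)
  have hlim : Filter.Tendsto (fun z => S⁻¹ * Um x y z * S) (Filter.cocompact ℂ) (nhds 1) := by
    simpa [Matrix.nonsing_inv_mul _ hS] using
      (hU1.tendsto_cocompact.const_mul S⁻¹).mul_const S
  have hfac' : ∀ z, z ≠ 0 →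
      S⁻¹ * Um x y z * S * (S⁻¹ * Vp x y z * Q) = hatUm x y z * hatVp x y z := fun z hz => by
    rw [← hfac z hz]
    simp only [Matrix.mul_assoc]
    rw [Matrix.mul_nonsing_inv_cancel_left _ _ hS]
  have hconst := inv_mul_eq_of_factorizations
    (A := fun z => (S⁻¹ * Vp x y z * Q)⁻¹) (B := fun z => (hatVp x y z)⁻¹)
    (P := fun z => (S⁻¹ * Um x y z * S)⁻¹) (N := fun z => (hatUm x y z)⁻¹)
    (differentiable_matrix_inv
      (differentiable_matrix_mul (differentiable_matrix_mul (differentiable_const _) hVd)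
        (differentiable_const _)) hV)
    (differentiable_matrix_inv hVd' hVu')
    (fun z => Matrix.isUnit_nonsing_inv_iff.2 (hV z))
    (fun z hz => Matrix.isUnit_nonsing_inv_iff.2 (hUu' z hz))
    (tendsto_inv_of_isUnit hlim isUnit_one)
    (tendsto_inv_of_isUnit hU1'.tendsto_cocompact isUnit_one) (by simp)
    (fun z hz => by rw [← Matrix.mul_inv_rev, ← Matrix.mul_inv_rev, hfac' z hz]) lam
  rw [Matrix.nonsing_inv_nonsing_inv _ ((Matrix.isUnit_iff_isUnit_det _).1 (hV lam))] at hconst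
  have hVdet := (Matrix.isUnit_iff_isUnit_det _).1 (hVu' lam)
  have hVV : S⁻¹ * Vp x y lam * Q = hatVp x y lam := by
    rw [← Matrix.nonsing_inv_mul_cancel_right _ (S⁻¹ * Vp x y lam * Q) hVdet, hconst]
    simp
  have := hfac' lam hlam
  rw [hVV] at this
  exact ((hVu' lam).mul_right_cancel this).symm

/-- Gauging the frame `U ↦ Û = R₀⁻¹·U·R` by a smooth diagonal SU(2)-valued rotation `R`
conjugates the Birkhoff factors and hence the normalized potentials by the constant
rotation `R₀ = R(0,0)`: `Û₊ = R₀⁻¹·U₊·R₀`, `η̂^x = R₀⁻¹·η^x·R₀`, and analogously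
`Û₋ = R₀⁻¹·U₋·R₀`, `η̂^y = R₀⁻¹·η^y·R₀`. -/
theorem gauged_frame_potentials_conjugate
    (I J : Set ℝ) (hI : IsOpen I) (hJ : IsOpen J)
    (hIc : I.OrdConnected) (hJc : J.OrdConnected) (h0I : (0:ℝ) ∈ I) (h0J : (0:ℝ) ∈ J)
    (U Up Vm Um Vp hatUp hatVm hatUm hatVp : ℝ → ℝ → ℂ → Matrix (Fin 2) (Fin 2) ℂ)
    (R : ℝ → ℝ → Matrix (Fin 2) (Fin 2) ℂ)
    -- the frame `U`
    (hUsm : ∀ lam : ℂ, lam ≠ 0 → ContDiffOn ℝ (⊤ : ℕ∞) (fun p : ℝ × ℝ => U p.1 p.2 lam) (I ×ˢ J))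
    (hUhol : ∀ x ∈ I, ∀ y ∈ J, DifferentiableOn ℂ (U x y) {0}ᶜ)
    (hUinv : ∀ x ∈ I, ∀ y ∈ J, ∀ lam : ℂ, lam ≠ 0 → IsUnit (U x y lam))
    -- the rotation `R`: smooth, diagonal, SU(2)-valued
    (hRsm : ContDiffOn ℝ (⊤ : ℕ∞) (fun p : ℝ × ℝ => R p.1 p.2) (I ×ˢ J))
    (hR : ∀ x ∈ I, ∀ y ∈ J,
      IsSU2 (R x y) ∧ R x y 0 1 = 0 ∧ R x y 1 0 = 0)
    -- factorizations of `U`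
    (hUpf : IsPlusFactor I J Up) (hVmf : IsMinusFactorInv I J Vm)
    (hfac : ∀ x ∈ I, ∀ y ∈ J, ∀ lam : ℂ, lam ≠ 0 →
      U x y lam = Up x y lam * Vm x y lam)
    (hUmf : IsMinusFactorOne I J Um) (hVpf : IsPlusFactorGen I J Vp)
    (hfac' : ∀ x ∈ I, ∀ y ∈ J, ∀ lam : ℂ, lam ≠ 0 →
      U x y lam = Um x y lam * Vp x y lam)
    -- factorizations of the gauged frame `Û = R₀⁻¹·U·R`
    (hhatUpf : IsPlusFactor I J hatUp) (hhatVmf : IsMinusFactorInv I J hatVm)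
    (hhatfac : ∀ x ∈ I, ∀ y ∈ J, ∀ lam : ℂ, lam ≠ 0 →
      (R 0 0)⁻¹ * U x y lam * R x y = hatUp x y lam * hatVm x y lam)
    (hhatUmf : IsMinusFactorOne I J hatUm) (hhatVpf : IsPlusFactorGen I J hatVp)
    (hhatfac' : ∀ x ∈ I, ∀ y ∈ J, ∀ lam : ℂ, lam ≠ 0 →
      (R 0 0)⁻¹ * U x y lam * R x y = hatUm x y lam * hatVp x y lam) :
    ∀ x ∈ I, ∀ y ∈ J,
      (∀ lam : ℂ, hatUp x y lam = (R 0 0)⁻¹ * Up x y lam * R 0 0) ∧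
      (∀ lam : ℂ,
        (hatUp x y lam)⁻¹ * deriv (fun x' => hatUp x' y lam) x =
          (R 0 0)⁻¹ * ((Up x y lam)⁻¹ * deriv (fun x' => Up x' y lam) x) * R 0 0) ∧
      (∀ lam : ℂ, lam ≠ 0 → hatUm x y lam = (R 0 0)⁻¹ * Um x y lam * R 0 0) ∧
      (∀ lam : ℂ, lam ≠ 0 →
        (hatUm x y lam)⁻¹ * deriv (fun y' => hatUm x y' lam) y =
          (R 0 0)⁻¹ * ((Um x y lam)⁻¹ * deriv (fun y' => Um x y' lam) y) * R 0 0) := by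
  have hS : IsUnit (R 0 0).det := (hR 0 h0I 0 h0J).1.isUnit_det
  have hplus : ∀ x ∈ I, ∀ y ∈ J, ∀ lam : ℂ,
      hatUp x y lam = (R 0 0)⁻¹ * Up x y lam * R 0 0 := fun x hx y hy =>
    gauged_plusFactor hx hy hS hUpf hVmf hhatUpf hhatVmf fun lam hlam => by
      rw [← hfac x hx y hy lam hlam, hhatfac x hx y hy lam hlam]
  have hminus : ∀ x ∈ I, ∀ y ∈ J, ∀ lam : ℂ, lam ≠ 0 →
      hatUm x y lam = (R 0 0)⁻¹ * Um x y lam * R 0 0 := fun x hx y hy _ =>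
    gauged_minusFactor hx hy hS (hR x hx y hy).1.isUnit_det hUmf hVpf hhatUmf hhatVpf
      fun lam hlam => by
        rw [← hfac' x hx y hy lam hlam, hhatfac' x hx y hy lam hlam]
  intro x hx y hy
  have hmem : I ×ˢ J ∈ nhds (x, y) := (hI.prod hJ).mem_nhds ⟨hx, hy⟩
  refine ⟨hplus x hx y hy, fun lam => ?_, hminus x hx y hy, fun lam hlam => ?_⟩
  · have hd : DifferentiableAt ℝ (fun p : ℝ × ℝ => Up p.1 p.2 lam) (x, y) :=
      ((hUpf.1 lam).contDiffAt hmem).differentiableAt (by simp)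
    refine inv_mul_deriv_conj (g := fun x' => hatUp x' y lam) (f := fun x' => Up x' y lam) hS
      (hd.comp (f := fun x' => (x', y)) x (by fun_prop)) ?_
    filter_upwards [hI.mem_nhds hx] with x' hx' using hplus x' hx' y hy lam
  · have hd : DifferentiableAt ℝ (fun p : ℝ × ℝ => Um p.1 p.2 lam) (x, y) :=
      ((hUmf.1 lam hlam).contDiffAt hmem).differentiableAt (by simp)
    refine inv_mul_deriv_conj (g := fun y' => hatUm x y' lam) (f := fun y' => Um x y' lam) hS
      (hd.comp (f := fun y' => (x, y')) y (by fun_prop)) ?_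
    filter_upwards [hJ.mem_nhds hy] with y' hy' using hminus x hx y' hy' lam hlam

end
end
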